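/- Every 2-connected [4,2]-graph of order n ≥ 7 is pancyclic: it contains a cycle of every length k with 3 ≤ k ≤ n. -/

import Mathlib

open SimpleGraph

/-- A graph `G` is an `[s,t]`-graph if every induced subgraph of order `s` has at least
`t` edges. -/
def IsSTGraph {V : Type*} [Fintype V] [DecidableEq V] (G : SimpleGraph V) [DecidableRel G.Adj]
    (s t : ℕ) : Prop :=
  ∀ S : Finset V, S.card = s → t ≤ (G.induce (S : Set V)).edgeFinset.card


/-- A graph is `k`-connected if it has more than `k` vertices and removing any set of fewer
than `k` vertices leaves a connected graph. -/
def IsKConnected {V : Type*} [Fintype V] (G : SimpleGraph V) (k : ℕ) : Prop :=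
  k < Fintype.card V ∧ ∀ S : Finset V, S.card < k → (G.induce ((↑S : Set V)ᶜ)).Connected

namespace P42

open SimpleGraph

/-- `l` lists the vertices of a cycle of `G` in cyclic order. -/
def Cyc {V : Type*} (G : SimpleGraph V) (l : List V) : Prop :=
  l.Nodup ∧ Cycle.Chain G.Adj (l : Cycle V)

variable {V : Type*} {G : SimpleGraph V}

lemma Cyc.rot {l₁ l₂ : List V} (h : Cyc G (l₁ ++ l₂)) : Cyc G (l₂ ++ l₁) := by
  refine ⟨List.nodup_append_comm.1 h.1, ?_⟩
  have : ((l₂ ++ l₁ : List V) : Cycle V) = ((l₁ ++ l₂ : List V) : Cycle V) :=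
    Cycle.coe_eq_coe.2 List.isRotated_append
  rw [this]; exact h.2

lemma cyc_cons {a : V} {l : List V} :
    Cyc G (a :: l) ↔ (a :: l).Nodup ∧ List.IsChain G.Adj (a :: (l ++ [a])) := by
  rw [Cyc, Cycle.chain_coe_cons]

lemma Cyc.toWalk {l : List V} (h : Cyc G l) (h3 : 3 ≤ l.length) :
    ∃ (v : V) (c : G.Walk v v), c.IsCycle ∧ c.length = l.length := by
  match l, h, h3 with
  | a :: b :: c :: l, h, _ =>
    rw [cyc_cons] at h
    obtain ⟨hn, hc⟩ := h
    simp only [List.cons_append, List.isChain_cons_cons] at hc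
    obtain ⟨hab, hbc, hc⟩ := hc
    have key : ∃ p : G.Walk c a, p.support = c :: (l ++ [a]) := by
      have := Walk.support_ofSupport (G := G) (List.cons_ne_nil c (l ++ [a])) hc
      have e : (c :: (l ++ [a])).getLast (List.cons_ne_nil c (l ++ [a])) = a := by simp
      exact ⟨(Walk.ofSupport (G := G) _ (List.cons_ne_nil c (l ++ [a])) hc).copy (by simp) e, by
        exact (Walk.support_copy _ _ _).trans this⟩
    obtain ⟨p, hp⟩ := key
    refine ⟨a, Walk.cons hab (Walk.cons hbc p), ?_, ?_⟩
    · rw [Walk.cons_isCycle_iff]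
      constructor
      · rw [Walk.isPath_def, Walk.support_cons, hp]
        grind
      · rw [Walk.edges_cons, List.mem_cons, not_or]
        constructor
        · intro h
          rw [Sym2.eq_iff] at h
          grind
        · intro h
          have := p.snd_mem_support_of_mem_edges h
          rw [hp] at this
          grind
    · have := p.length_support
      rw [hp] at this
      simp at this ⊢
      omega

lemma four [Fintype V] [DecidableEq V] [DecidableRel G.Adj] (hst : IsSTGraph G 4 2)
    {a b c d : V} (hab : a ≠ b) (hac : a ≠ c) (had : a ≠ d) (hbc : b ≠ c) (hbd : b ≠ d)
    (hcd : c ≠ d) : G.Adj a c ∨ G.Adj a d ∨ G.Adj b c ∨ G.Adj b d ∨ G.Adj c d := by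
  by_contra hcon
  push Not at hcon
  obtain ⟨h1, h2, h3, h4, h5⟩ := hcon
  have := hst {a, b, c, d} (by
    rw [Finset.card_eq_of_equiv_fin]; exact (by
      have : ({a, b, c, d} : Finset V).card = 4 := by
        simp [hab, hac, had, hbc, hbd, hcd]
      exact Finset.equivFinOfCardEq this))
  have h2' : (G.induce ((({a, b, c, d} : Finset V) : Set V))).edgeFinset ⊆
      {s(⟨a, by simp⟩, ⟨b, by simp⟩)} := by
    intro e
    induction e using Sym2.ind with
    | _ x y =>
      obtain ⟨x, hx⟩ := x
      obtain ⟨y, hy⟩ := y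
      simp only [mem_edgeFinset, mem_edgeSet, comap_adj, Function.Embedding.subtype_apply,
        Finset.mem_singleton, Sym2.eq_iff, Subtype.mk.injEq]
      intro hxy
      have hne := hxy.ne
      simp at hx hy
      have := hxy.symm
      rcases hx with rfl | rfl | rfl | rfl <;> rcases hy with rfl | rfl | rfl | rfl <;>
        simp_all
  have := Finset.card_le_card h2'
  simp at this
  omega

lemma cross [Fintype V] (hc : IsKConnected G 2) (c : V) (X : Set V) {x y : V}
    (hx : x ∈ X) (hy : y ∉ X) (hxc : x ≠ c) (hyc : y ≠ c) :
    ∃ p q, p ∈ X ∧ q ∉ X ∧ p ≠ c ∧ q ≠ c ∧ G.Adj p q := by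
  have := (hc.2 {c} (by simp)).preconnected ⟨x, by simpa using hxc⟩ ⟨y, by simpa using hyc⟩
  obtain ⟨w⟩ := this
  obtain ⟨d, -, h1, h2⟩ := w.exists_boundary_dart (Subtype.val ⁻¹' X) hx hy
  refine ⟨d.fst, d.snd, h1, h2, ?_, ?_, d.adj⟩
  · simpa using d.fst.2
  · simpa using d.snd.2

/-- `l` is (the vertex list of) a walk from `a` to `b`. -/
def Pth (G : SimpleGraph V) (a b : V) (l : List V) : Prop :=
  l.IsChain G.Adj ∧ l.head? = some a ∧ l.getLast? = some b

lemma Pth.single (a : V) : Pth G a a [a] := by simp [Pth]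

lemma Pth.append {a b c d : V} {l₁ l₂ : List V} (h₁ : Pth G a b l₁) (h : G.Adj b c)
    (h₂ : Pth G c d l₂) : Pth G a d (l₁ ++ l₂) := by
  obtain ⟨h1, h2, h3⟩ := h₁
  obtain ⟨h4, h5, h6⟩ := h₂
  refine ⟨List.isChain_append.2 ⟨h1, h4, ?_⟩, ?_, ?_⟩
  · rw [h3, h5]; simpa using h
  · simp [h2]
  · simp [h6]

lemma Pth.cons {a b c : V} {l : List V} (h : G.Adj a b) (h₂ : Pth G b c l) :
    Pth G a c (a :: l) := (Pth.single a).append h h₂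

lemma Pth.rev {a b : V} {l : List V} (h : Pth G a b l) : Pth G b a l.reverse := by
  obtain ⟨h1, h2, h3⟩ := h
  refine ⟨List.isChain_reverse.2 (h1.imp fun _ _ h => h.symm), ?_, ?_⟩ <;> simp [h2, h3]

lemma exists_pth {l : List V} (h : l.IsChain G.Adj) (hn : l ≠ []) : ∃ a b, Pth G a b l :=
  ⟨l.head hn, l.getLast hn, h, List.head?_eq_some_head hn, List.getLast?_eq_some_getLast hn⟩

lemma Pth.split {a b : V} {l₁ l₂ : List V} (h : Pth G a b (l₁ ++ l₂)) (h1 : l₁ ≠ [])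
    (h2 : l₂ ≠ []) : ∃ c d, Pth G a c l₁ ∧ G.Adj c d ∧ Pth G d b l₂ := by
  obtain ⟨h3, h4, h5⟩ := h
  obtain ⟨h6, h7, h8⟩ := List.isChain_append.1 h3
  obtain ⟨a', c, hc⟩ := exists_pth h6 h1
  obtain ⟨d, b', hd⟩ := exists_pth h7 h2
  have e1 : a' = a := by
    have := hc.2.1
    simpa [this] using h4
  have e2 : b' = b := by
    have := hd.2.2
    simpa [this] using h5
  subst e1 e2
  exact ⟨c, d, hc, h8 c hc.2.2 d hd.2.1, hd⟩

lemma Pth.head_mem {a b : V} {l : List V} (h : Pth G a b l) : a ∈ l :=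
  List.mem_of_mem_head? h.2.1

lemma Pth.last_mem {a b : V} {l : List V} (h : Pth G a b l) : b ∈ l :=
  List.mem_of_getLast? h.2.2

lemma Pth.cons_eq {a b x : V} {l : List V} (h : Pth G a b (x :: l)) : x = a := by
  simpa using h.2.1

lemma Pth.cyc {a b : V} {l : List V} (h : Pth G a b l) (hn : l.Nodup) (hb : G.Adj b a) :
    Cyc G l := by
  cases l with
  | nil => simp [Pth] at h
  | cons x l =>
    have := h.cons_eq
    subst this
    rw [cyc_cons]
    exact ⟨hn, (h.append hb (Pth.single x)).1⟩

lemma Cyc.pth {l : List V} (h : Cyc G l) (hn : l ≠ []) : ∃ a b, Pth G a b l ∧ G.Adj b a := by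
  cases l with
  | nil => simp at hn
  | cons x l =>
    rw [cyc_cons, ← List.cons_append] at h
    obtain ⟨h1, h2⟩ := h
    obtain ⟨a, b, hab⟩ := exists_pth h2 (by simp)
    obtain ⟨c, d, h3, h4, h5⟩ := hab.split (by simp) (by simp)
    refine ⟨a, c, h3, ?_⟩
    rw [← h3.cons_eq, h5.cons_eq]
    exact h4

lemma Cyc.elim {u w : V} {P Q : List V} (h : Cyc G (u :: P ++ w :: Q)) (hP : P ≠ [])
    (hQ : Q ≠ []) : ∃ p p' q q', Pth G p p' P ∧ Pth G q q' Q ∧ G.Adj u p ∧ G.Adj p' w ∧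
      G.Adj w q ∧ G.Adj q' u := by
  obtain ⟨a, b, hab, hba⟩ := h.pth (by simp)
  obtain ⟨c, d, h1, h2, h3⟩ := hab.split (by simp) (by simp)
  obtain ⟨c', p, h4, h5, h6⟩ := Pth.split (l₁ := [u]) h1 (by simp) hP
  obtain ⟨d', q, h7, h8, h9⟩ := Pth.split (l₁ := [w]) h3 (by simp) hQ
  have e1 := h4.cons_eq
  have e2 := h7.cons_eq
  have e3 : u = c' := by simpa [Pth] using h4.2.2
  have e4 : w = d' := by simpa [Pth] using h7.2.2
  subst e1 e2 e3 e4
  exact ⟨p, c, q, b, h6, h9, h5, h2, h8, hba⟩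

lemma Cyc.elim1 {u w : V} {P : List V} (h : Cyc G (u :: P ++ [w])) (hP : P ≠ []) :
    ∃ p p', Pth G p p' P ∧ G.Adj u p ∧ G.Adj p' w ∧ G.Adj w u := by
  obtain ⟨a, b, hab, hba⟩ := h.pth (by simp)
  obtain ⟨c, d, h1, h2, h3⟩ := hab.split (by simp) (by simp)
  obtain ⟨c', p, h4, h5, h6⟩ := Pth.split (l₁ := [u]) h1 (by simp) hP
  have e1 := h4.cons_eq
  have e3 : u = c' := by simpa [Pth] using h4.2.2
  have e2 := h3.cons_eq
  have e4 : w = b := by simpa [Pth] using h3.2.2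
  subst e1 e2 e3 e4
  exact ⟨p, c, h6, h5, h2, hba⟩

lemma Cyc.rot2 {u w : V} {P Q : List V} (h : Cyc G (u :: P ++ w :: Q)) :
    Cyc G (w :: Q ++ u :: P) := h.rot

/-- The cycle `l` can be extended by one. -/
def Ext (G : SimpleGraph V) (l : List V) : Prop :=
  ∃ l', Cyc G l' ∧ l'.length = l.length + 1

lemma Ext.congr {l l' : List V} (h : Ext G l) (e : l.length = l'.length) : Ext G l' := by
  unfold Ext at *; rwa [← e]

lemma Cyc.split2 {l : List V} (h : Cyc G l) {u w : V} (hu : u ∈ l) (hw : w ∈ l) (hne : u ≠ w) :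
    ∃ P Q, Cyc G (u :: P ++ w :: Q) ∧ (u :: P ++ w :: Q).Perm l := by
  obtain ⟨L, R, rfl⟩ := List.append_of_mem hu
  have h' := h.rot
  have hw' : w ∈ R ++ L := by
    simp only [List.mem_append, List.mem_cons] at hw ⊢
    rcases hw with h | h | h
    · exact Or.inr h
    · exact absurd h.symm hne
    · exact Or.inl h
  obtain ⟨P, Q, e⟩ := List.append_of_mem hw'
  have e' : u :: R ++ L = u :: P ++ w :: Q := by simp [e]
  refine ⟨P, Q, e' ▸ h', ?_⟩
  rw [← e']
  exact List.perm_append_comm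

lemma insert1 {u w v : V} {L : List V} (h : Cyc G (u :: w :: L)) (hv : v ∉ u :: w :: L)
    (h1 : G.Adj v u) (h2 : G.Adj v w) : Ext G (u :: w :: L) := by
  refine ⟨u :: v :: w :: L, ?_, by simp⟩
  rw [cyc_cons] at h ⊢
  have := h1.symm
  simp_all
  tauto

lemma crossing {u w v p p' q q' : V} {P Q : List V} (h : Cyc G (u :: P ++ w :: Q))
    (hv : v ∉ u :: P ++ w :: Q) (h1 : G.Adj v u) (h2 : G.Adj v w)
    (hP : Pth G p p' P) (hQ : Pth G q q' Q) (a1 : G.Adj p' w) (a2 : G.Adj q' u)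
    (h3 : G.Adj p q) : Ext G (u :: P ++ w :: Q) := by
  refine ⟨v :: u :: (Q.reverse ++ (P ++ [w])), ?_, by simp <;> omega⟩
  refine Pth.cyc (((hQ.rev.append h3.symm (hP.append a1 (.single w))).cons a2.symm).cons h1) ?_
    h2.symm
  have hn : (v :: (u :: P ++ w :: Q)).Nodup := List.nodup_cons.2 ⟨hv, h.1⟩
  refine (List.Perm.nodup_iff ?_).1 hn
  classical
  rw [List.perm_iff_count]
  intro a
  simp only [List.count_cons, List.count_append, List.count_reverse, List.cons_append,
    List.count_nil]
  ring

lemma crossing' {u w v p p' q q' : V} {P Q : List V} (h : Cyc G (u :: P ++ w :: Q))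
    (hv : v ∉ u :: P ++ w :: Q) (h1 : G.Adj v u) (h2 : G.Adj v w)
    (hP : Pth G p p' P) (hQ : Pth G q q' Q) (a1 : G.Adj u p) (a2 : G.Adj w q)
    (h3 : G.Adj p' q') : Ext G (u :: P ++ w :: Q) := by
  refine ⟨v :: u :: (P ++ (Q.reverse ++ [w])), ?_, by simp <;> omega⟩
  refine Pth.cyc (((hP.append h3 (hQ.rev.append a2.symm (.single w))).cons a1).cons h1) ?_
    h2.symm
  have hn : (v :: (u :: P ++ w :: Q)).Nodup := List.nodup_cons.2 ⟨hv, h.1⟩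
  refine (List.Perm.nodup_iff ?_).1 hn
  classical
  rw [List.perm_iff_count]
  intro a
  simp only [List.count_cons, List.count_append, List.count_reverse, List.cons_append,
    List.count_nil]
  ring

lemma detour {u w v p p2 p' q q' : V} {P Q : List V} (h : Cyc G (u :: (p :: P) ++ w :: Q))
    (hv : v ∉ u :: (p :: P) ++ w :: Q) (h1 : G.Adj v u) (h2 : G.Adj v w)
    (hP : Pth G p2 p' P) (hQ : Pth G q q' Q) (a1 : G.Adj u p) (a2 : G.Adj p' w)
    (h3 : G.Adj p q') (h4 : G.Adj q p2) : Ext G (u :: (p :: P) ++ w :: Q) := by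
  refine ⟨v :: u :: p :: (Q.reverse ++ (P ++ [w])), ?_, by simp <;> omega⟩
  refine Pth.cyc ((((hQ.rev.append h4 (hP.append a2 (.single w))).cons h3).cons a1).cons h1) ?_
    h2.symm
  have hn : (v :: (u :: (p :: P) ++ w :: Q)).Nodup := List.nodup_cons.2 ⟨hv, h.1⟩
  refine (List.Perm.nodup_iff ?_).1 hn
  classical
  rw [List.perm_iff_count]
  intro a
  simp only [List.count_cons, List.count_append, List.count_reverse, List.cons_append,
    List.count_nil]
  ring
/-- The `[4,2]` property in a first-order form. -/
def Four (G : SimpleGraph V) : Prop :=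
  ∀ a b c d : V, a ≠ b → a ≠ c → a ≠ d → b ≠ c → b ≠ d → c ≠ d →
    G.Adj a c ∨ G.Adj a d ∨ G.Adj b c ∨ G.Adj b d ∨ G.Adj c d

lemma succs {u w v : V} {P Q : List V} (h : Cyc G (u :: P ++ w :: Q))
    (hv : v ∉ u :: P ++ w :: Q) (h1 : G.Adj v u) (h2 : G.Adj v w)
    (hno : ¬ Ext G (u :: P ++ w :: Q)) :
    ∃ p P' q Q', P = p :: P' ∧ Q = q :: Q' ∧ ¬ G.Adj p q ∧ ¬ G.Adj v p ∧ ¬ G.Adj v q := by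
  have hno' : ¬ Ext G (w :: Q ++ u :: P) := fun h => hno (h.congr (by simp <;> omega))
  have hv' : v ∉ w :: Q ++ u :: P := by
    simp only [List.mem_append] at hv ⊢; tauto
  have h' := h.rot2
  cases P with
  | nil => exact absurd (insert1 h hv h1 h2) hno
  | cons p P =>
    cases Q with
    | nil => exact absurd (insert1 h' hv' h2 h1) hno'
    | cons q Q =>
      refine ⟨p, P, q, Q, rfl, rfl, fun h3 => ?_, fun h3 => ?_, fun h3 => ?_⟩
      · obtain ⟨p0, p', q0, q', hP, hQ, a1, a2, a3, a4⟩ := h.elim (by simp) (by simp)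
        have e1 := hP.cons_eq
        have e2 := hQ.cons_eq
        subst e1 e2
        exact hno (crossing h hv h1 h2 hP hQ a2 a4 h3)
      · exact hno (insert1 h hv h1 h3)
      · exact hno' (insert1 h' hv' h2 h3)

lemma three (hF : Four G) {u w x v : V} {P Q R : List V}
    (h : Cyc G (u :: P ++ w :: (Q ++ x :: R)))
    (hv : v ∉ u :: P ++ w :: (Q ++ x :: R)) (h1 : G.Adj v u) (h2 : G.Adj v w)
    (h3 : G.Adj v x) : Ext G (u :: P ++ w :: (Q ++ x :: R)) := by
  by_contra hno
  obtain ⟨p, P', q, Q', rfl, e, n1, n2, n3⟩ := succs h hv h1 h2 hno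
  have hr : Cyc G (w :: Q ++ x :: (R ++ u :: (p :: P'))) := by
    have := h.rot2
    simpa using this
  obtain ⟨q1, Q1, r, R', rfl, e', n4, n5, n6⟩ := succs hr
    (by simp at hv ⊢; tauto) h2 h3
    (fun h => hno (h.congr (by simp <;> omega)))
  have hr2 : Cyc G (x :: R ++ u :: (p :: P' ++ w :: (q1 :: Q1))) := by
    have := hr.rot2
    simpa using this
  obtain ⟨r1, R1, p1, P1, rfl, e'', n7, n8, n9⟩ := succs hr2
    (by simp at hv ⊢; tauto) h3 h1
    (fun h => hno (h.congr (by simp <;> omega)))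
  simp only [List.cons_append, List.cons.injEq] at e e' e''
  obtain ⟨rfl, -⟩ := e
  obtain ⟨rfl, -⟩ := e'
  obtain ⟨rfl, -⟩ := e''
  have hn := h.1
  simp [List.nodup_append] at hn hv
  have := hF v p q1 r1 (by tauto) (by tauto) (by tauto) (by grind) (by grind) (by grind)
  have := G.adj_comm r1 p
  tauto

lemma kfour [Fintype V] (hcard : 7 ≤ Fintype.card V) (hF : Four G) {u p w q v : V}
    (hn : [u, p, w, q, v].Nodup) (a1 : G.Adj u p) (a2 : G.Adj p w) (a3 : G.Adj w q)
    (a4 : G.Adj q u) (a5 : G.Adj v u) (a6 : G.Adj v w) (n1 : ¬ G.Adj v p) (n2 : ¬ G.Adj v q)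
    (n3 : ¬ G.Adj p q) : ∃ l, Cyc G l ∧ l.length = 5 := by
  by_contra hno
  have h5 : ∀ a b c d e : V, [a, b, c, d, e].Nodup → G.Adj a b → G.Adj b c → G.Adj c d →
      G.Adj d e → G.Adj e a → False := by
    intro a b c d e hn h1 h2 h3 h4 h5
    exact hno ⟨[a, b, c, d, e], by rw [cyc_cons]; exact ⟨hn, by simp [*]⟩, rfl⟩
  classical
  obtain ⟨x, hx⟩ : ∃ x, x ∉ ({u, p, w, q, v} : Finset V) := by
    by_contra! hc
    have := Finset.card_le_card (fun x _ => hc x : Finset.univ ⊆ _)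
    have h2 := Finset.card_le_five (a := u) (b := p) (c := w) (d := q) (e := v)
    rw [Finset.card_univ] at this
    omega
  obtain ⟨y, hy⟩ : ∃ y, y ∉ ({x, u, p, w, q, v} : Finset V) := by
    by_contra! hc
    have := Finset.card_le_card (fun x _ => hc x : Finset.univ ⊆ _)
    have h2 := Finset.card_le_six (a := x) (b := u) (c := p) (d := w) (e := q) (f := v)
    rw [Finset.card_univ] at this
    omega
  simp only [Finset.mem_insert, Finset.mem_singleton, not_or] at hx hy
  obtain ⟨x1, x2, x3, x4, x5⟩ := hx
  obtain ⟨y0, y1, y2, y3, y4, y5⟩ := hy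
  simp at hn
  obtain ⟨⟨up, uw, uq, uv⟩, ⟨pw, pq, pv⟩, ⟨wq, wv⟩, qv⟩ := hn
  have key : ∀ z, z ≠ u → z ≠ p → z ≠ w → z ≠ q → z ≠ v →
      ((G.Adj z p ∧ G.Adj z q) ∨ (G.Adj z p ∧ G.Adj z v) ∨ (G.Adj z q ∧ G.Adj z v)) ∧
      ¬ G.Adj z u ∧ ¬ G.Adj z w := by
    intro z z1 z2 z3 z4 z5
    have f1 := hF z p q v z2 z4 z5 pq pv qv
    have f2 := hF z q p v z4 z2 z5 (Ne.symm pq) qv pv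
    have f3 := hF z v p q z5 z2 z4 (Ne.symm pv) (Ne.symm qv) pq
    have c1 := G.adj_comm p v
    have c2 := G.adj_comm q v
    have c3 := G.adj_comm q p
    have two : (G.Adj z p ∧ G.Adj z q) ∨ (G.Adj z p ∧ G.Adj z v) ∨
      (G.Adj z q ∧ G.Adj z v) := by
      clear h5 hno hF
      by_cases g1 : G.Adj z p <;> by_cases g2 : G.Adj z q <;> by_cases g3 : G.Adj z v <;>
        simp_all
    have b1 : ∀ s t, s ≠ t → s ≠ z → t ≠ z → s ≠ u → t ≠ u → s ≠ w → t ≠ w → G.Adj s u →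
        G.Adj s w → G.Adj t u → G.Adj t w → G.Adj z s → ¬ G.Adj z u ∧ ¬ G.Adj z w := by
      intro s t h1 h2 h3 h4 h5' h6 h7 h8 h9 h10 h11 h12
      constructor <;> intro hh
      · exact h5 u z s w t (by simp; grind) hh.symm h12 h9 h11.symm h10
      · exact h5 w z s u t (by simp; grind) hh.symm h12 h8 h10.symm h11
    refine ⟨two, ?_⟩
    rcases two with ⟨h, -⟩ | ⟨h, -⟩ | ⟨h, -⟩
    · exact b1 p q pq z2.symm z4.symm (Ne.symm up) (Ne.symm uq) pw (Ne.symm wq) a1.symm a2 a4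
        a3.symm h
    · exact b1 p q pq z2.symm z4.symm (Ne.symm up) (Ne.symm uq) pw (Ne.symm wq) a1.symm a2 a4
        a3.symm h
    · exact b1 q p (Ne.symm pq) z4.symm z2.symm (Ne.symm uq) (Ne.symm up) (Ne.symm wq) pw a4
        a3.symm a1.symm a2 h
  obtain ⟨tx, xu, xw⟩ := key x x1 x2 x3 x4 x5
  obtain ⟨ty, yu, yw⟩ := key y y1 y2 y3 y4 y5
  have hxy : G.Adj x y := by
    have := hF u w x y uw (Ne.symm x1) (Ne.symm y1) (Ne.symm x3) (Ne.symm y3) (Ne.symm y0)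
    have := G.adj_comm u x
    have := G.adj_comm u y
    have := G.adj_comm w x
    have := G.adj_comm w y
    clear key h5 hno hF
    simp_all
  have fin : ∀ s t, s ≠ t → s ≠ x → s ≠ y → s ≠ u → t ≠ x → t ≠ y → t ≠ u → G.Adj s u →
      G.Adj t u → G.Adj x s → G.Adj y s → G.Adj x t → False := by
    intro s t h1 h2 h3 h4 h5' h6 h7 h8 h9 h10 h11 h12
    exact h5 x t u s y (by simp; grind) h12 h9 h8.symm h11.symm hxy.symm
  have fpq := fin p q pq (Ne.symm x2) (Ne.symm y2) (Ne.symm up) (Ne.symm x4) (Ne.symm y4)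
    (Ne.symm uq) a1.symm a4
  have fqp := fin q p (Ne.symm pq) (Ne.symm x4) (Ne.symm y4) (Ne.symm uq) (Ne.symm x2)
    (Ne.symm y2) (Ne.symm up) a4 a1.symm
  have fpv := fin p v pv (Ne.symm x2) (Ne.symm y2) (Ne.symm up) (Ne.symm x5) (Ne.symm y5)
    (Ne.symm uv) a1.symm a5
  have fvp := fin v p (Ne.symm pv) (Ne.symm x5) (Ne.symm y5) (Ne.symm uv) (Ne.symm x2)
    (Ne.symm y2) (Ne.symm up) a5 a1.symm
  have fqv := fin q v qv (Ne.symm x4) (Ne.symm y4) (Ne.symm uq) (Ne.symm x5) (Ne.symm y5)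
    (Ne.symm uv) a4 a5
  have fvq := fin v q (Ne.symm qv) (Ne.symm x5) (Ne.symm y5) (Ne.symm uv) (Ne.symm x4)
    (Ne.symm y4) (Ne.symm uq) a5 a4
  clear fin key h5 hno hF
  rcases tx with ⟨t1, t2⟩ | ⟨t1, t2⟩ | ⟨t1, t2⟩ <;>
    rcases ty with ⟨s1, s2⟩ | ⟨s1, s2⟩ | ⟨s1, s2⟩ <;> simp_all

lemma two [Fintype V] (hcard : 7 ≤ Fintype.card V) (hF : Four G) {l : List V} (hl : Cyc G l)
    {u w v : V} (hv : v ∉ l) (hu : u ∈ l) (hw : w ∈ l) (huw : u ≠ w) (h1 : G.Adj v u)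
    (h2 : G.Adj v w) : Ext G l := by
  obtain ⟨P, Q, h, hperm⟩ := hl.split2 hu hw huw
  refine Ext.congr (l := u :: P ++ w :: Q) ?_ hperm.length_eq
  have hv : v ∉ u :: P ++ w :: Q := fun h => hv (hperm.mem_iff.1 h)
  clear hperm hl hu hw
  by_contra hno
  have nP : ∀ x ∈ P, ¬ G.Adj v x := by
    intro x hx hvx
    obtain ⟨A, B, rfl⟩ := List.append_of_mem hx
    have hno' : ¬ Ext G (w :: Q ++ u :: (A ++ x :: B)) :=
      fun h => hno (h.congr (by simp <;> omega))
    exact hno' (three hF h.rot2 (by simp at hv ⊢; tauto) h2 h1 hvx)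
  have nQ : ∀ x ∈ Q, ¬ G.Adj v x := by
    intro x hx hvx
    obtain ⟨A, B, rfl⟩ := List.append_of_mem hx
    exact hno (three hF h hv h1 h2 hvx)
  obtain ⟨p, P', q, Q', rfl, rfl, n1, n2, n3⟩ := succs h hv h1 h2 hno
  obtain ⟨p0, p', q0, q', hP, hQ, a1, a2, a3, a4⟩ := h.elim (by simp) (by simp)
  have e1 := hP.cons_eq
  have e2 := hQ.cons_eq
  subst e1 e2
  have n4 : ¬ G.Adj p' q' := fun h3 => hno (crossing' h hv h1 h2 hP hQ a1 a3 h3)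
  have hn := h.1
  have M : ∀ y x z, y ∈ (p :: P') ++ (q :: Q') → x ∈ (p :: P') ++ (q :: Q') →
      z ∈ (p :: P') ++ (q :: Q') → y ≠ x → y ≠ z → x ≠ z → ¬ G.Adj y x → G.Adj y z := by
    intro y x z hy hx hz h3 h4 h5 h6
    have g : ∀ t ∈ (p :: P') ++ (q :: Q'), v ≠ t ∧ ¬ G.Adj v t := by
      intro t ht
      rw [List.mem_append] at ht
      constructor
      · rintro rfl
        apply hv
        simp at ht ⊢
        tauto
      · exact ht.elim (nP t) (nQ t)
    obtain ⟨hy1, hy2⟩ := g y hy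
    obtain ⟨hx1, hx2⟩ := g x hx
    obtain ⟨hz1, hz2⟩ := g z hz
    have := hF x z v y h5 hx1.symm h3.symm hz1.symm h4.symm hy1
    have := G.adj_comm x v
    have := G.adj_comm z v
    have := G.adj_comm x y
    have := G.adj_comm z y
    tauto
  have hp' := hP.last_mem
  have hq' := hQ.last_mem
  have dis : ∀ x ∈ p :: P', ∀ y ∈ q :: Q', x ≠ y := by
    have := hn
    simp only [List.cons_append, List.nodup_cons, List.nodup_append] at this
    grind
  have ndP : (p :: P').Nodup := by
    simp only [List.cons_append, List.nodup_cons, List.nodup_append] at hn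
    grind
  have ndQ : (q :: Q').Nodup := by
    simp only [List.cons_append, List.nodup_cons, List.nodup_append] at hn
    grind
  cases P' with
  | nil =>
    have ep : p' = p := by simpa using hp'
    subst ep
    cases Q' with
    | nil =>
      have eq : q' = q := by simpa using hq'
      subst eq
      refine hno (kfour hcard hF (u := u) (p := p') (w := w) (q := q') (v := v) ?_ a1 a2 a3 a4 h1
        h2 n2 n3 n1)
      clear M
      simp at hn hv ⊢
      grind
    | cons q2 Q2 =>
      have hqq : q ≠ q' := by
        rintro rfl
        have := hQ.2.2
        have : q ∈ q2 :: Q2 := List.mem_of_getLast? (by simpa using this)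
        exact (List.nodup_cons.1 ndQ).1 this
      exact n4 (M p' q q' (by simp) (by simp) (List.mem_append_right _ hq')
        (dis _ (by simp) _ (by simp)) (dis _ (by simp) _ hq') hqq n1)
  | cons p2 P2 =>
    have hpp : p ≠ p' := by
      rintro rfl
      have := hP.2.2
      have : p ∈ p2 :: P2 := List.mem_of_getLast? (by simpa using this)
      exact (List.nodup_cons.1 ndP).1 this
    cases Q' with
    | nil =>
      have eq : q' = q := by simpa using hq'
      subst eq
      exact n4 (M q' p p' (by simp) (by simp) (List.mem_append_left _ hp')
        (dis _ (by simp) _ (by simp)).symm (dis _ hp' _ (by simp)).symm hpp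
        (fun h => n1 h.symm)).symm
    | cons q2 Q2 =>
      have hqq : q ≠ q' := by
        rintro rfl
        have := hQ.2.2
        have : q ∈ q2 :: Q2 := List.mem_of_getLast? (by simpa using this)
        exact (List.nodup_cons.1 ndQ).1 this
      have b1 : G.Adj p q' := M p q q' (by simp) (by simp) (List.mem_append_right _ hq')
        (dis _ (by simp) _ (by simp)) (dis _ (by simp) _ hq') hqq n1
      have b2 : G.Adj q p2 := M q p p2 (by simp) (by simp) (by simp)
        (dis _ (by simp) _ (by simp)).symm (dis _ (by simp) _ (by simp)).symm
        (by rintro rfl; simp at ndP) (fun h => n1 h.symm)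
      obtain ⟨c, d, g1, g2, g3⟩ := Pth.split (l₁ := [p]) hP (by simp) (by simp)
      have e3 := g3.cons_eq
      subst e3
      exact hno (detour h hv h1 h2 g3 hQ a1 a2 b1 b2)
lemma exists_notin [Fintype V] (l : List V) (h : l.length < Fintype.card V) : ∃ x, x ∉ l := by
  classical
  by_contra! hc
  have := Finset.card_le_card (fun x _ => List.mem_toFinset.2 (hc x) : Finset.univ ⊆ l.toFinset)
  have h2 := l.toFinset_card_le
  rw [Finset.card_univ] at this
  omega

/-- every vertex outside `l` has at most one neighbour on `l` -/
def One (G : SimpleGraph V) (l : List V) : Prop :=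
  ∀ v, v ∉ l → ∀ u ∈ l, ∀ w ∈ l, G.Adj v u → G.Adj v w → u = w

lemma exists_edges [Fintype V] (hc : IsKConnected G 2) {l : List V} (hn : l.Nodup)
    (h2 : 2 ≤ l.length) (hlt : l.length < Fintype.card V) (h1 : One G l) :
    ∃ c₁ c₂ o₁ o₂, c₁ ∈ l ∧ c₂ ∈ l ∧ o₁ ∉ l ∧ o₂ ∉ l ∧ c₁ ≠ c₂ ∧ o₁ ≠ o₂ ∧
      G.Adj o₁ c₁ ∧ G.Adj o₂ c₂ := by
  obtain ⟨o, ho⟩ := exists_notin l hlt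
  have key : ∀ c ∈ l, ∃ p q, p ∈ l ∧ q ∉ l ∧ p ≠ c ∧ G.Adj p q := by
    intro c hcl
    have : ∃ x ∈ l, x ≠ c := by
      match l, hn, h2 with
      | a :: b :: l, hn, _ =>
        by_cases e : a = c
        · refine ⟨b, by simp, ?_⟩
          rintro rfl
          simp [e] at hn
        · exact ⟨a, by simp, e⟩
    obtain ⟨x, hx, hxc⟩ := this
    obtain ⟨p, q, a1, a2, a3, a4, a5⟩ := cross hc c {z | z ∈ l} (x := x) (y := o) hx ho hxc
      (by rintro rfl; exact ho hcl)
    exact ⟨p, q, a1, a2, a3, a5⟩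
  obtain ⟨c, hcl⟩ : ∃ c, c ∈ l := by
    cases l with
    | nil => simp at h2
    | cons a l => exact ⟨a, by simp⟩
  obtain ⟨c1, o1, m1, m2, m3, m4⟩ := key c hcl
  obtain ⟨c2, o2, k1, k2, k3, k4⟩ := key c1 m1
  refine ⟨c1, c2, o1, o2, m1, k1, m2, k2, k3.symm, ?_, m4.symm, k4.symm⟩
  rintro rfl
  exact k3 (h1 _ m2 _ k1 _ m1 k4.symm m4.symm)

lemma gen4 (hF : Four G) {o s t o₃ : V} (e1 : s ≠ t) (e2 : s ≠ o) (e3 : t ≠ o) (e4 : s ≠ o₃)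
    (e5 : t ≠ o₃) (e6 : o ≠ o₃) (e7 : ¬ G.Adj o s) (e8 : ¬ G.Adj o t) (e9 : ¬ G.Adj o₃ s)
    (e10 : ¬ G.Adj o₃ t) : G.Adj o o₃ := by
  have f1 := hF s t o o₃ e1 e2 e4 e3 e5 e6
  rw [G.adj_comm s, G.adj_comm s, G.adj_comm t, G.adj_comm t] at f1
  simpa [e7, e8, e9, e10] using f1

set_option maxHeartbeats 1000000 in
lemma core [Fintype V] (hcard : 7 ≤ Fintype.card V) (hF : Four G) {c₁ c₂ o₁ o₂ : V}
    {A B : List V} (h : Cyc G (c₁ :: A ++ c₂ :: B)) (h1 : One G (c₁ :: A ++ c₂ :: B))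
    (m1 : o₁ ∉ c₁ :: A ++ c₂ :: B) (m2 : o₂ ∉ c₁ :: A ++ c₂ :: B) (ho : o₁ ≠ o₂)
    (a1 : G.Adj o₁ c₁) (a2 : G.Adj o₂ c₂) (hlen : 2 ≤ A.length + B.length)
    (hAB : B.length ≤ A.length) : Ext G (c₁ :: A ++ c₂ :: B) := by
  have hn := h.1
  have hnn : ((A ++ B) ++ [o₁, o₂, c₁, c₂]).Nodup := by
    have : (o₁ :: o₂ :: (c₁ :: A ++ c₂ :: B)).Nodup := by
      rw [List.nodup_cons, List.nodup_cons]
      exact ⟨by rw [List.mem_cons, not_or]; exact ⟨ho, m1⟩, m2, hn⟩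
    refine (List.Perm.nodup_iff ?_).1 this
    classical
    rw [List.perm_iff_count]
    intro a
    simp only [List.count_cons, List.count_append, List.cons_append, List.count_nil]
    ring
  have hnAB : (A ++ B).Nodup := (List.nodup_append.1 hnn).1
  have memAB : ∀ x ∈ A ++ B, x ∈ c₁ :: A ++ c₂ :: B ∧ x ≠ c₁ ∧ x ≠ c₂ ∧ x ≠ o₁ ∧ x ≠ o₂ := by
    intro x hx
    have := (List.nodup_append.1 hnn).2.2 x hx
    refine ⟨?_, this _ (by simp), this _ (by simp), this _ (by simp), this _ (by simp)⟩
    simp only [List.mem_append, List.mem_cons] at hx ⊢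
    tauto
  have na : ∀ x ∈ A ++ B, ¬ G.Adj o₁ x ∧ ¬ G.Adj o₂ x := by
    intro x hx
    obtain ⟨g1, g2, g3, -, -⟩ := memAB x hx
    exact ⟨fun hh => g2 (h1 o₁ m1 x g1 c₁ (by simp) hh a1),
      fun hh => g3 (h1 o₂ m2 x g1 c₂ (by simp) hh a2)⟩
  have cl : ∀ x ∈ A ++ B, ∀ y ∈ A ++ B, x ≠ y → G.Adj x y ∧ G.Adj o₁ o₂ := by
    intro x hx y hy hxy
    obtain ⟨n1, n2⟩ := na x hx
    obtain ⟨n3, n4⟩ := na y hy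
    obtain ⟨-, -, -, d1, d2⟩ := memAB x hx
    obtain ⟨-, -, -, d3, d4⟩ := memAB y hy
    have f1 := hF x y o₁ o₂ hxy d1 d2 d3 d4 ho
    have f2 := hF o₁ o₂ x y ho d1.symm d3.symm d2.symm d4.symm hxy
    rw [G.adj_comm x, G.adj_comm x, G.adj_comm y, G.adj_comm y] at f1
    tauto
  have oo : G.Adj o₁ o₂ := by
    obtain ⟨x, y, L, e⟩ : ∃ x y L, A ++ B = x :: y :: L := by
      have : 2 ≤ (A ++ B).length := by simpa using hlen
      match A ++ B, this with
      | x :: y :: L, _ => exact ⟨x, y, L, rfl⟩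
    refine (cl x (by simp [e]) y (by simp [e]) ?_).2
    rintro rfl
    simp [e] at hnAB
  cases B with
  | nil =>
    obtain ⟨p, p', hP, b1, b2, b3⟩ := h.elim1 (by rintro rfl; simp at hlen)
    match A, hlen with
    | [x, y], _ =>
      obtain ⟨o₃, ho3⟩ := exists_notin [x, y, o₁, o₂, c₁, c₂] (by simp; omega)
      have m3 : o₃ ∉ c₁ :: [x, y] ++ [c₂] := by simp at ho3 ⊢; tauto
      have hxm := memAB x (by simp)
      have hym := memAB y (by simp)
      have hxy : x ≠ y := by rintro rfl; simp at hnAB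
      have hcc : c₁ ≠ c₂ := by rintro rfl; simp at hnn
      have o3' := h1 o₃ m3
      have k1 := o3' x (by simp) y (by simp)
      have k2 := o3' x (by simp) c₁ (by simp)
      have k3 := o3' x (by simp) c₂ (by simp)
      have k4 := o3' y (by simp) c₁ (by simp)
      have k5 := o3' y (by simp) c₂ (by simp)
      have l1 : ¬ G.Adj o₁ c₂ := fun hh => hcc (h1 o₁ m1 c₁ (by simp) c₂ (by simp) a1 hh)
      have l2 : ¬ G.Adj o₂ c₁ := fun hh => hcc (h1 o₂ m2 c₁ (by simp) c₂ (by simp) hh a2)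
      have hx := na x (by simp)
      have hy := na y (by simp)
      simp only [List.mem_cons, List.not_mem_nil, or_false, not_or] at ho3
      obtain ⟨z1, z2, z3, z4, z5, z6⟩ := ho3
      have gen := fun o s t => gen4 hF (o := o) (s := s) (t := t) (o₃ := o₃)
      have m1' : c₂ ≠ o₁ := by rintro rfl; simp at m1
      have m2' : c₁ ≠ o₂ := by rintro rfl; simp at m2
      have q1 : G.Adj o₁ o₃ := by
        by_cases g1 : G.Adj o₃ x
        · exact gen o₁ y c₂ hym.2.2.1 hym.2.2.2.1 m1' (Ne.symm z2) (Ne.symm z6) (Ne.symm z3)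
            hy.1 l1 (fun g => hxy (k1 g1 g)) (fun g => hxm.2.2.1 (k3 g1 g))
        · by_cases g2 : G.Adj o₃ y
          · exact gen o₁ x c₂ hxm.2.2.1 hxm.2.2.2.1 m1' (Ne.symm z1) (Ne.symm z6) (Ne.symm z3)
              hx.1 l1 g1 (fun g => hym.2.2.1 (k5 g2 g))
          · exact gen o₁ x y hxy hxm.2.2.2.1 hym.2.2.2.1 (Ne.symm z1) (Ne.symm z2) (Ne.symm z3)
              hx.1 hy.1 g1 g2
      have q2 : G.Adj o₂ o₃ := by
        by_cases g1 : G.Adj o₃ x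
        · exact gen o₂ y c₁ hym.2.1 hym.2.2.2.2 m2' (Ne.symm z2) (Ne.symm z5) (Ne.symm z4)
            hy.2 l2 (fun g => hxy (k1 g1 g)) (fun g => hxm.2.1 (k2 g1 g))
        · by_cases g2 : G.Adj o₃ y
          · exact gen o₂ x c₁ hxm.2.1 hxm.2.2.2.2 m2' (Ne.symm z1) (Ne.symm z5) (Ne.symm z4)
              hx.2 l2 g1 (fun g => hym.2.1 (k4 g2 g))
          · exact gen o₂ x y hxy hxm.2.2.2.2 hym.2.2.2.2 (Ne.symm z1) (Ne.symm z2) (Ne.symm z4)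
              hx.2 hy.2 g1 g2
      refine ⟨[c₁, o₁, o₃, o₂, c₂], ?_, rfl⟩
      rw [cyc_cons]
      constructor
      · clear gen na cl memAB h1
        simp at hnn ⊢
        grind
      · simp [a1.symm, q1, q2.symm, a2, b3]
    | x :: y :: z :: A', _ =>
      have e1 := hP.cons_eq
      subst e1
      obtain ⟨c, d, g1, g2, g3⟩ := Pth.split (l₁ := [x, y]) (l₂ := z :: A') hP (by simp) (by simp)
      have e3 := g3.cons_eq
      subst e3
      have hxz : G.Adj x z := (cl x (by simp) z (by simp) (by rintro rfl; simp at hnAB)).1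
      refine ⟨o₁ :: c₁ :: x :: ((z :: A') ++ [c₂, o₂]), ?_, by simp⟩
      refine Pth.cyc (((((g3.append b2 (Pth.cons a2.symm (.single o₂))).cons hxz).cons b1).cons
        a1)) ?_ oo.symm
      refine List.Nodup.sublist (l₂ := y :: (o₁ :: c₁ :: x :: ((z :: A') ++ [c₂, o₂])))
        (by simp) ?_
      refine (List.Perm.nodup_iff ?_).1 hnn
      classical
      rw [List.perm_iff_count]
      intro a
      simp only [List.count_cons, List.count_append, List.cons_append, List.count_nil]
      ring
  | cons b B =>
    obtain ⟨p, p', q, q', hP, hQ, b1, b2, b3, b4⟩ :=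
      h.elim (by rintro rfl; simp at hAB) (by simp)
    have e2 := hQ.cons_eq
    subst e2
    match A, hAB with
    | [x], hAB =>
      have : B = [] := by
        rw [← List.length_eq_zero_iff]; simpa using hAB
      subst this
      have e1 := hP.cons_eq
      subst e1
      have e3 : x = p' := by simpa using hP.2.2
      subst e3
      refine ⟨[o₁, c₁, x, c₂, o₂], ?_, rfl⟩
      rw [cyc_cons]
      constructor
      · clear na cl memAB h1
        simp at hnn ⊢
        grind
      · simp [a1, b1, b2, a2.symm, oo.symm]
    | x :: y :: A', _ =>
      have e1 := hP.cons_eq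
      subst e1
      obtain ⟨c, d, g1, g2, g3⟩ := Pth.split (l₁ := [x]) (l₂ := y :: A') hP (by simp) (by simp)
      have e3 := g3.cons_eq
      subst e3
      have hxz : G.Adj b y := (cl b (by simp) y (by simp) (by rintro rfl; simp at hnAB)).1
      refine ⟨o₁ :: c₁ :: ((b :: B).reverse ++ ((y :: A') ++ [c₂, o₂])), ?_, by simp <;> omega⟩
      refine Pth.cyc ((((hQ.rev.append hxz (g3.append b2 (Pth.cons a2.symm (.single o₂)))).cons
        b4.symm).cons a1)) ?_ oo.symm
      refine List.Nodup.sublist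
        (l₂ := x :: (o₁ :: c₁ :: ((b :: B).reverse ++ ((y :: A') ++ [c₂, o₂])))) (by simp) ?_
      refine (List.Perm.nodup_iff ?_).1 hnn
      classical
      rw [List.perm_iff_count]
      intro a
      simp only [List.count_cons, List.count_append, List.cons_append, List.count_nil,
        List.count_reverse]
      ring

lemma kthree [Fintype V] (hcard : 7 ≤ Fintype.card V) (hF : Four G) {c₁ c₂ c₃ o₁ o₂ : V}
    (hn : [c₁, c₂, c₃].Nodup) (t1 : G.Adj c₁ c₂)
    (h1 : One G [c₁, c₂, c₃]) (m1 : o₁ ∉ [c₁, c₂, c₃]) (m2 : o₂ ∉ [c₁, c₂, c₃])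
    (ho : o₁ ≠ o₂) (a1 : G.Adj o₁ c₁) (a2 : G.Adj o₂ c₂) (t2 : G.Adj c₂ c₃)
    (t3 : G.Adj c₃ c₁) : ∃ l, Cyc G l ∧ l.length = 4 := by
  by_contra hno
  have h4 : ∀ a b c d : V, [a, b, c, d].Nodup → G.Adj a b → G.Adj b c → G.Adj c d →
      G.Adj d a → False := by
    intro a b c d hn h1 h2 h3 h4
    exact hno ⟨[a, b, c, d], by rw [cyc_cons]; exact ⟨hn, by simp [*]⟩, rfl⟩
  obtain ⟨x, hx⟩ := exists_notin [c₁, c₂, c₃, o₁, o₂] (by simp; omega)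
  obtain ⟨y, hy⟩ := exists_notin [x, c₁, c₂, c₃, o₁, o₂] (by simp; omega)
  have hnn : [c₁, c₂, c₃, o₁, o₂].Nodup := by
    simp at hn m1 m2 ⊢
    grind
  have on : ∀ v, v ∉ [c₁, c₂, c₃] → (G.Adj v c₁ → ¬ G.Adj v c₂ ∧ ¬ G.Adj v c₃) ∧
      (G.Adj v c₂ → ¬ G.Adj v c₁ ∧ ¬ G.Adj v c₃) := by
    intro v hv
    have k1 := h1 v hv c₁ (by simp) c₂ (by simp)
    have k2 := h1 v hv c₁ (by simp) c₃ (by simp)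
    have k3 := h1 v hv c₂ (by simp) c₃ (by simp)
    simp at hn
    tauto
  obtain ⟨o1c2, o1c3⟩ := (on o₁ m1).1 a1
  obtain ⟨o2c1, o2c3⟩ := (on o₂ m2).2 a2
  have n12 : ¬ G.Adj o₁ o₂ := fun hh =>
    h4 o₁ o₂ c₂ c₁ (by simp at hnn ⊢; grind) hh a2 t1.symm a1.symm
  have key : ∀ z, z ∉ [c₁, c₂, c₃, o₁, o₂] → G.Adj z o₁ ∧ G.Adj z o₂ := by
    intro z hz
    have hz3 : z ∉ [c₁, c₂, c₃] := by simp at hz ⊢; tauto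
    have hznn : [c₁, c₂, c₃, o₁, o₂, z].Nodup := by
      simp at hz hnn ⊢
      grind
    clear hnn hn m1 m2 hx hy
    have ozn := on z hz3
    have sy := G.adj_comm
    simp only [List.nodup_cons, List.mem_cons, List.not_mem_nil, or_false, not_or,
      not_false_eq_true, List.nodup_nil, and_true] at hznn
    obtain ⟨⟨d1, d2, d3, d4, d5⟩, ⟨d6, d7, d8, d9⟩, ⟨d10, d11, d12⟩, ⟨d13, d14⟩, d15⟩ := hznn
    have zc1 : ¬ G.Adj z c₁ := by
      intro hh
      have z2 : ¬ G.Adj z o₂ := fun g =>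
        h4 z o₂ c₂ c₁ (by simp; grind) g a2 t1.symm hh.symm
      have := hF o₁ z o₂ c₃ d14 d13 (Ne.symm d10) (Ne.symm d15) (Ne.symm d12) (Ne.symm d11)
      tauto
    have zc2 : ¬ G.Adj z c₂ := by
      intro hh
      have z2 : ¬ G.Adj z o₁ := fun g =>
        h4 z o₁ c₁ c₂ (by simp; grind) g a1 t1 hh.symm
      have := hF o₂ z o₁ c₃ d15 (Ne.symm d13) (Ne.symm d11) (Ne.symm d14) (Ne.symm d12)
        (Ne.symm d10)
      rw [sy o₂ o₁] at this
      tauto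
    have zc3 : ¬ G.Adj z c₃ := by
      intro hh
      have z1 : ¬ G.Adj z o₁ := fun g =>
        h4 z o₁ c₁ c₃ (by simp; grind) g a1 t3.symm hh.symm
      have z2 : ¬ G.Adj z o₂ := fun g =>
        h4 z o₂ c₂ c₃ (by simp; grind) g a2 t2 hh.symm
      have := hF c₁ o₁ z o₂ d3 d5 d4 d14 d13 (Ne.symm d15)
      rw [sy c₁ z, sy c₁ o₂, sy o₁ z] at this
      tauto
    constructor
    · have := hF c₂ c₃ z o₁ d6 d9 d7 d12 d10 (Ne.symm d14)
      rw [sy c₂ z, sy c₂ o₁, sy c₃ z, sy c₃ o₁] at this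
      tauto
    · have := hF c₁ c₃ z o₂ d2 d5 d4 d12 d11 (Ne.symm d15)
      rw [sy c₁ z, sy c₁ o₂, sy c₃ z, sy c₃ o₂] at this
      tauto
  obtain ⟨x1, x2⟩ := key x hx
  obtain ⟨y1, y2⟩ := key y (by simp at hy ⊢; tauto)
  exact h4 o₁ x o₂ y (by simp at hx hy ⊢; grind) x1.symm x2 y2.symm y1

lemma step [Fintype V] (hcard : 7 ≤ Fintype.card V) (hF : Four G) (hc : IsKConnected G 2)
    {l : List V} (hl : Cyc G l) (h3 : 3 ≤ l.length) (hlt : l.length < Fintype.card V) :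
    Ext G l := by
  by_contra hno
  have h1 : One G l := by
    intro v hv u hu w hw a1 a2
    by_contra hne
    exact hno (two hcard hF hl hv hu hw hne a1 a2)
  obtain ⟨c₁, c₂, o₁, o₂, m1, m2, m3, m4, cne, one, a1, a2⟩ :=
    exists_edges hc hl.1 (by omega) hlt h1
  obtain ⟨A, B, h, hperm⟩ := hl.split2 m1 m2 cne
  have hlen := hperm.length_eq
  have hno' : ∀ l', Cyc G l' → l'.length ≠ l.length + 1 := fun l' h e => hno ⟨l', h, e⟩
  have h1' : ∀ l' : List V, l'.Perm l → One G l' := by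
    intro l' hp v hv u hu w hw
    exact h1 v (fun h => hv (hp.mem_iff.2 h)) u (hp.mem_iff.1 hu) w (hp.mem_iff.1 hw)
  have hnot : ∀ l' : List V, l'.Perm l → ∀ o, o ∉ l → o ∉ l' := by
    intro l' hp o ho h
    exact ho (hp.mem_iff.1 h)
  have hperm' : (c₂ :: B ++ c₁ :: A).Perm l := List.perm_append_comm.trans hperm
  have hle := hlen
  simp at hle
  by_cases hk : l.length = 3
  · have hex : ∀ A B : List V, Cyc G (c₁ :: A ++ c₂ :: B) → A.length + B.length = 1 →
        ∃ c₃, Cyc G (c₁ :: A ++ c₂ :: B) ∧ ([c₁, c₂, c₃]).Perm (c₁ :: A ++ c₂ :: B) ∧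
        G.Adj c₁ c₂ ∧ G.Adj c₂ c₃ ∧ G.Adj c₃ c₁ := by
      intro A B h e
      have h' := h
      rcases (by omega : (A.length = 0 ∧ B.length = 1) ∨ (A.length = 1 ∧ B.length = 0)) with
        ⟨e1, e2⟩ | ⟨e1, e2⟩
      · obtain ⟨c, rfl⟩ := List.length_eq_one_iff.1 e2
        obtain rfl := List.length_eq_zero_iff.1 e1
        simp [cyc_cons] at h'
        exact ⟨c, h, by simp, by tauto⟩
      · obtain ⟨c, rfl⟩ := List.length_eq_one_iff.1 e1
        obtain rfl := List.length_eq_zero_iff.1 e2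
        simp [cyc_cons] at h'
        refine ⟨c, h, ?_, h'.2.2.2.symm, h'.2.2.1.symm, h'.2.1.symm⟩
        exact (List.Perm.swap _ _ _).cons _
    obtain ⟨c₃, -, hp, t1, t2, t3⟩ := hex A B h (by omega)
    have hp' := hp.trans hperm
    obtain ⟨l', e1, e2⟩ := kthree hcard hF (hp'.nodup_iff.2 hl.1) t1 (h1' _ hp')
      (hnot _ hp' _ m3) (hnot _ hp' _ m4) one a1 a2 t2 t3
    exact hno' l' e1 (by omega)
  · rcases le_total B.length A.length with hAB | hAB
    · obtain ⟨l', e1, e2⟩ := core hcard hF h (h1' _ hperm) (hnot _ hperm _ m3)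
        (hnot _ hperm _ m4) one a1 a2 (by omega) hAB
      exact hno' l' e1 (by omega)
    · obtain ⟨l', e1, e2⟩ := core hcard hF h.rot2 (h1' _ hperm') (hnot _ hperm' _ m4)
        (hnot _ hperm' _ m3) one.symm a2 a1 (by omega) hAB
      have := hperm'.length_eq
      exact hno' l' e1 (by omega)
lemma exists_deg_three [Fintype V] (hcard : 7 ≤ Fintype.card V) (hF : Four G)
    (hc : IsKConnected G 2) : ∃ x a b c : V, a ≠ b ∧ a ≠ c ∧ b ≠ c ∧ G.Adj x a ∧ G.Adj x b ∧
      G.Adj x c := by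
  classical
  by_contra! hno
  obtain ⟨x, -⟩ := exists_notin ([] : List V) (by simp; omega)
  set N : Finset V := Finset.univ.filter (fun y => G.Adj x y) with hN
  set R : Finset V := Finset.univ.filter (fun y => y ≠ x ∧ ¬ G.Adj x y) with hR
  have hNc : N.card ≤ 2 := by
    by_contra! h
    obtain ⟨a, h1, b, h2, c, h3, h4, h5, h6⟩ := Finset.two_lt_card.1 h
    simp only [hN, Finset.mem_filter, Finset.mem_univ, true_and] at h1 h2 h3
    exact hno x a b c h4 h5 h6 h1 h2 h3
  have hU : (Finset.univ : Finset V) ⊆ insert x (N ∪ R) := by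
    intro y _
    simp only [hN, hR, Finset.mem_insert, Finset.mem_union, Finset.mem_filter, Finset.mem_univ,
      true_and]
    tauto
  have hRc : 4 ≤ R.card := by
    have h1 := Finset.card_le_card hU
    have h2 := Finset.card_insert_le x (N ∪ R)
    have h3 := Finset.card_union_le N R
    rw [Finset.card_univ] at h1
    omega
  have mR : ∀ y, y ∈ R ↔ y ≠ x ∧ ¬ G.Adj x y := by simp [hR]
  obtain ⟨r, hr, r', hr', hrr⟩ := Finset.one_lt_card.1 (by omega : 1 < R.card)
  obtain ⟨p, q, p1, p2, -, -, p3⟩ := cross hc r' (R : Set V) (x := r) (y := x) hr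
    (by simp [hR]) hrr ((mR r').1 hr').1.symm
  simp only [Finset.mem_coe] at p1 p2
  have hE : 2 < (R.erase p).card := by
    rw [Finset.card_erase_of_mem p1]; omega
  obtain ⟨a, h1, b, h2, c, h3, h4, h5, h6⟩ := Finset.two_lt_card.1 hE
  rw [Finset.mem_erase] at h1 h2 h3
  have key : ∀ s ∈ R, ∀ t ∈ R, s ≠ p → t ≠ p → s ≠ t → ¬ G.Adj p s → G.Adj p t := by
    intro s hs t ht e1 e2 e3 e4
    by_contra e5
    obtain ⟨s1, s2⟩ := (mR s).1 hs
    obtain ⟨t1, t2⟩ := (mR t).1 ht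
    obtain ⟨k1, k2⟩ := (mR p).1 p1
    exact k2 (gen4 hF e3 s1 t1 e1 e2 k1.symm s2 t2 e4 e5)
  have ne : ∀ s ∈ R, s ≠ q := by rintro s hs rfl; exact p2 hs
  by_cases g1 : G.Adj p a
  · by_cases g2 : G.Adj p b
    · exact hno p a b q h4 (ne a h1.2) (ne b h2.2) g1 g2 p3
    · exact hno p a c q h5 (ne a h1.2) (ne c h3.2) g1 (key b h2.2 c h3.2 h2.1 h3.1 h6 g2) p3
  · exact hno p b c q h6 (ne b h2.2) (ne c h3.2) (key a h1.2 b h2.2 h1.1 h2.1 h4 g1)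
      (key a h1.2 c h3.2 h1.1 h3.1 h5 g1) p3

lemma exists_triangle [Fintype V] (hcard : 7 ≤ Fintype.card V) (hF : Four G)
    (hc : IsKConnected G 2) : ∃ l, Cyc G l ∧ l.length = 3 := by
  by_contra hno
  have T : ∀ a b c, G.Adj a b → G.Adj b c → ¬ G.Adj c a := by
    intro a b c h1 h2 h3
    refine hno ⟨[a, b, c], ?_, rfl⟩
    rw [cyc_cons]
    refine ⟨?_, by simp [*]⟩
    simp [h1.ne, h2.ne, h3.ne.symm]
  obtain ⟨x, a, b, c, ab, ac, bc, xa, xb, xc⟩ := exists_deg_three hcard hF hc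
  have nab : ¬ G.Adj a b := fun h => T x a b xa h xb.symm
  have nac : ¬ G.Adj a c := fun h => T x a c xa h xc.symm
  have nbc : ¬ G.Adj b c := fun h => T x b c xb h xc.symm
  obtain ⟨y, hy⟩ := exists_notin [x, a, b, c] (by simp; omega)
  obtain ⟨z, hz⟩ := exists_notin [y, x, a, b, c] (by simp; omega)
  obtain ⟨w, hw⟩ := exists_notin [z, y, x, a, b, c] (by simp; omega)
  simp only [List.mem_cons, List.not_mem_nil, or_false, not_or] at hy hz hw
  have key : ∀ t, t ≠ a → t ≠ b → t ≠ c → (G.Adj t a ∧ G.Adj t b) ∨ (G.Adj t a ∧ G.Adj t c) ∨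
      (G.Adj t b ∧ G.Adj t c) := by
    intro t ta tb tc
    have f1 := hF t a b c ta tb tc ab ac bc
    have f2 := hF t b a c tb ta tc ab.symm bc ac
    have f3 := hF t c a b tc ta tb ac.symm bc.symm ab
    rw [G.adj_comm b a] at f2
    rw [G.adj_comm c a, G.adj_comm c b] at f3
    clear hno T
    simp only [nab, nac, nbc, or_false] at f1 f2 f3
    tauto
  have nx : ∀ t, t ≠ a → t ≠ b → t ≠ c → ¬ G.Adj x t := by
    intro t ta tb tc h
    rcases key t ta tb tc with ⟨h1, -⟩ | ⟨h1, -⟩ | ⟨h1, -⟩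
    · exact T x t a h h1 xa.symm
    · exact T x t a h h1 xa.symm
    · exact T x t b h h1 xb.symm
  have ny : ∀ t, t ≠ a → t ≠ b → t ≠ c → ∀ s, s ≠ a → s ≠ b → s ≠ c → ¬ G.Adj s t := by
    intro t ta tb tc s sa sb sc h
    have g : ∀ d, G.Adj t d → ¬ G.Adj s d := fun d h1 h2 => T s t d h h1 h2.symm
    have ga := g a
    have gb := g b
    have gc := g c
    rcases key t ta tb tc with ⟨h1, h1'⟩ | ⟨h1, h1'⟩ | ⟨h1, h1'⟩ <;>
      rcases key s sa sb sc with ⟨h2, h2'⟩ | ⟨h2, h2'⟩ | ⟨h2, h2'⟩ <;>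
      first | exact ga ‹_› ‹_› | exact gb ‹_› ‹_› | exact gc ‹_› ‹_›
  obtain ⟨y0, y1, y2, y3⟩ := hy
  obtain ⟨z9, z0, z1, z2, z3⟩ := hz
  obtain ⟨w8, w9, w0, w1, w2, w3⟩ := hw
  rcases hF x y z w (Ne.symm y0) (Ne.symm z0) (Ne.symm w0) (Ne.symm z9) (Ne.symm w9)
    (Ne.symm w8) with h | h | h | h | h
  · exact nx z z1 z2 z3 h
  · exact nx w w1 w2 w3 h
  · exact ny z z1 z2 z3 y y1 y2 y3 h
  · exact ny w w1 w2 w3 y y1 y2 y3 h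
  · exact ny w w1 w2 w3 z z1 z2 z3 h

end P42

/-- every 2-connected `[4,2]`-graph of order `n ≥ 7` is pancyclic: it contains
a cycle of every length `k` with `3 ≤ k ≤ n`. -/
theorem two_connected_42_graph_pancyclic {V : Type*} [Fintype V] [DecidableEq V]
    (G : SimpleGraph V) [DecidableRel G.Adj] (n : ℕ) (horder : Fintype.card V = n)
    (hn : 7 ≤ n) (hconn : IsKConnected G 2) (hst : IsSTGraph G 4 2) :
    ∀ k : ℕ, 3 ≤ k → k ≤ n → ∃ (v : V) (c : G.Walk v v), c.IsCycle ∧ c.length = k := by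
  have hF : P42.Four G := fun a b c d h1 h2 h3 h4 h5 h6 => P42.four hst h1 h2 h3 h4 h5 h6
  have hcard : 7 ≤ Fintype.card V := by omega
  intro k hk
  have main : k ≤ n → ∃ l : List V, P42.Cyc G l ∧ l.length = k := by
    induction k, hk using Nat.le_induction with
    | base => exact fun _ => P42.exists_triangle hcard hF hconn
    | succ k hk ih =>
      intro hkn
      obtain ⟨l, hl, hlen⟩ := ih (by omega)
      obtain ⟨l', h1, h2⟩ := P42.step hcard hF hconn hl (by omega) (by omega)
      exact ⟨l', h1, by omega⟩
  intro hkn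
  obtain ⟨l, hl, hlen⟩ := main hkn
  obtain ⟨v, c, h1, h2⟩ := hl.toWalk (by omega)
  exact ⟨v, c, h1, by omega⟩
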